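/- Let c ≥ 2 and let G be a finitely generated nilpotent group with lowerCentralSeries G c = ⊥ that admits a nonzero homomorphism to ℤ, and set K = lowerCentralSeries G (c−1). Let S ⊆ G and suppose that for every nonzero homomorphism φ : G → ℝ there exists s ∈ S with φ(s) < 0. Then the set S⁺·K = {w·z : w ∈ S⁺, z ∈ K} is the underlying set of a finite-index subgroup of G. -/

import Mathlib

universe u

lemma ratl (s : Finset ℝ) (hs : ∀ r ∈ s, 0 < r) : ∃ f : ℝ →ₗ[ℚ] ℚ, ∀ r ∈ s, 0 < f r := by
  classical
  let W := Submodule.span ℚ (s : Set ℝ)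
  let b := Module.finBasis ℚ W
  let emb : (Fin (Module.finrank ℚ W) → ℚ) → (Fin (Module.finrank ℚ W) → ℝ) := fun q i => (q i : ℝ)
  have hd : DenseRange emb := by
    have := DenseRange.piMap (fun _ : Fin (Module.finrank ℚ W) => Rat.denseRange_cast (𝕜 := ℝ))
    exact this
  have hmem : ∀ r ∈ s, r ∈ W := fun r hr => Submodule.subset_span hr
  let U : Set (Fin (Module.finrank ℚ W) → ℝ) :=
    {y | ∀ r : s, 0 < ∑ j, ((b.repr ⟨r, hmem r r.2⟩ j : ℚ) : ℝ) * y j}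
  have hU : IsOpen U := by
    have : U = ⋂ r : s, {y | 0 < ∑ j, ((b.repr ⟨r, hmem r r.2⟩ j : ℚ) : ℝ) * y j} := by
      ext y; simp [U]
    rw [this]
    exact isOpen_iInter_of_finite fun r => isOpen_lt continuous_const (by fun_prop)
  have hne : U.Nonempty := by
    refine ⟨fun j => (b j : ℝ), fun r => ?_⟩
    have h1 := congrArg (Subtype.val) (b.sum_repr ⟨r, hmem r r.2⟩)
    have h2 : ∑ j, ((b.repr ⟨r, hmem r r.2⟩ j : ℚ) : ℝ) * (b j : ℝ) = r := by
      refine Eq.trans ?_ h1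
      rw [Submodule.coe_sum]
      refine Finset.sum_congr rfl fun j _ => ?_
      rw [Submodule.coe_smul, Rat.smul_def]
    rw [h2]
    exact hs r r.2
  obtain ⟨q, hq⟩ := hd.exists_mem_open hU hne
  obtain ⟨f, hf⟩ := LinearMap.exists_extend (b.constr ℚ q : W →ₗ[ℚ] ℚ)
  refine ⟨f, fun r hr => ?_⟩
  have h1 : f r = b.constr ℚ q ⟨r, hmem r hr⟩ := by rw [← hf]; rfl
  rw [h1, b.constr_apply_fintype ℚ]
  have := hq ⟨r, hr⟩
  simp only [emb] at this
  have h3 : (0:ℝ) < ((∑ i, b.equivFun ⟨r, hmem r hr⟩ i • q i : ℚ) : ℝ) := by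
    push_cast
    simpa [smul_eq_mul] using this
  exact_mod_cast h3

lemma cone_top {n : ℕ} (T : Set (Fin n → ℝ))
    (h : ∀ φ : (Fin n → ℝ) →L[ℝ] ℝ, φ ≠ 0 → ∃ t ∈ T, φ t < 0) (x : Fin n → ℝ) :
    x ∈ Submodule.span NNReal T := by
  let C : PointedCone ℝ (Fin n → ℝ) := PointedCone.hull ℝ T
  have hconv : Convex ℝ (C : Set (Fin n → ℝ)) := PointedCone.convex C
  have hcl : closure (C : Set (Fin n → ℝ)) = Set.univ := by
    by_contra hne
    obtain ⟨x, hx⟩ := (Set.ne_univ_iff_exists_notMem _).1 hne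
    obtain ⟨f, u, h1, h2⟩ := geometric_hahn_banach_closed_point hconv.closure isClosed_closure hx
    have h0 : (0:ℝ) < u := by simpa using h1 0 (subset_closure C.zero_mem)
    have hf : -f ≠ 0 := by
      intro hf
      have : f = 0 := by simpa using hf
      rw [this] at h2
      simp at h2; linarith
    obtain ⟨t, ht, hlt⟩ := h (-f) hf
    have hlt' : 0 < f t := by simpa using hlt
    have htC : t ∈ C := Submodule.subset_span ht
    obtain ⟨k, hk⟩ := exists_nat_gt (u / f t)
    have := h1 ((k:ℕ) • t) (subset_closure (C.nsmul_mem htC k))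
    rw [map_nsmul, nsmul_eq_mul] at this
    rw [div_lt_iff₀ hlt'] at hk
    linarith
  have hint : (interior (C : Set (Fin n → ℝ))).Nonempty := by
    rw [hconv.interior_nonempty_iff_affineSpan_eq_top]
    rw [← AffineSubspace.coe_eq_univ_iff]
    apply Set.eq_univ_of_univ_subset
    rw [← hcl]
    exact closure_minimal (subset_affineSpan ℝ _) (AffineSubspace.closed_of_finiteDimensional _)
  have h3 := hconv.interior_closure_eq_interior_of_nonempty_interior hint
  rw [hcl, interior_univ] at h3
  exact interior_subset (h3 ▸ Set.mem_univ x : x ∈ interior (C : Set (Fin n → ℝ)))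

lemma clear_den (s : Finset ℚ) (hs : ∀ q ∈ s, 0 ≤ q) :
    ∃ D : ℕ, 0 < D ∧ ∀ q ∈ s, ∃ k : ℕ, (D : ℚ) * q = k := by
  classical
  induction s using Finset.induction_on with
  | empty => exact ⟨1, one_pos, by simp⟩
  | insert a s ha ih =>
    obtain ⟨D, hD, h⟩ := ih fun q hq => hs q (Finset.mem_insert_of_mem hq)
    refine ⟨D * a.den, Nat.mul_pos hD a.den_pos, fun q hq => ?_⟩
    rcases Finset.mem_insert.1 hq with rfl | hq
    · refine ⟨D * q.num.toNat, ?_⟩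
      have h0 := hs q (Finset.mem_insert_self _ _)
      have h1 : ((q.num.toNat : ℤ)) = q.num := Int.toNat_of_nonneg (Rat.num_nonneg.2 h0)
      have h2 : ((q.num.toNat : ℚ)) = q.num := by exact_mod_cast h1
      push_cast
      rw [h2, mul_assoc, Rat.den_mul_eq_num]
    · obtain ⟨k, hk⟩ := h q hq
      refine ⟨k * a.den, ?_⟩
      push_cast
      rw [← hk]; ring

lemma coords (A : Type*) [AddCommGroup A] [AddGroup.FG A] :
    ∃ (n : ℕ) (π : A →+ (Fin n → ℤ)), Function.Surjective π ∧
      ∀ a, π a = 0 → ∃ m : ℕ, 0 < m ∧ m • a = 0 := by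
  have : Module.Finite ℤ A := Module.Finite.iff_addGroup_fg.mpr inferInstance
  let b := Module.finBasis ℤ (A ⧸ Submodule.torsion ℤ A)
  refine ⟨_, (b.equivFun.toLinearMap.comp (Submodule.mkQ _)).toAddMonoidHom, ?_, ?_⟩
  · exact b.equivFun.surjective.comp (Submodule.mkQ_surjective _)
  · intro a ha
    have h1 : Submodule.mkQ (Submodule.torsion ℤ A) a = 0 := b.equivFun.map_eq_zero_iff.1 ha
    have h2 : a ∈ Submodule.torsion ℤ A := by simpa using h1
    rw [Submodule.mem_torsion_iff] at h2
    obtain ⟨⟨m, hm⟩, hma⟩ := h2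
    have hm0 : m ≠ 0 := nonZeroDivisors.ne_zero hm
    refine ⟨m.natAbs, Int.natAbs_pos.2 hm0, ?_⟩
    have hma : m • a = 0 := hma
    rw [← natCast_zsmul]
    rcases Int.natAbs_eq m with h | h
    · rw [← h]; exact hma
    · rw [h, neg_smul, neg_eq_zero] at hma; exact hma

lemma ab_neg {A : Type*} [AddCommGroup A] [AddGroup.FG A] (T : Set A)
    (h : ∀ φ : A →+ ℝ, φ ≠ 0 → ∃ t ∈ T, φ t < 0) (t : A) (ht : t ∈ T) :
    -t ∈ AddSubmonoid.closure T := by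
  classical
  obtain ⟨n, π, hπ, hker⟩ := coords A
  let ι : A →+ (Fin n → ℝ) :=
    { toFun := fun a i => (π a i : ℝ)
      map_zero' := by ext; simp
      map_add' := by intros; ext; simp }
  have hcone := cone_top (ι '' T) (by
    intro φ hφ
    have : (φ : (Fin n → ℝ) →+ ℝ).comp ι ≠ 0 := by
      intro h0
      apply hφ
      apply ContinuousLinearMap.coe_injective
      refine (Pi.basisFun ℝ (Fin n)).ext fun i => ?_
      obtain ⟨a, ha⟩ := hπ (Pi.single i 1)
      have h1 := DFunLike.congr_fun h0 a
      have h2 : ι a = Pi.basisFun ℝ (Fin n) i := by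
        ext j
        simp [ι, ha, Pi.single_apply]
      simpa [← h2] using h1
    obtain ⟨t, ht, hlt⟩ := h _ this
    exact ⟨ι t, ⟨t, ht, rfl⟩, hlt⟩) (-ι t)
  obtain ⟨f, F, hF, -, hsum⟩ := Submodule.mem_span_iff_exists_finset_subset.1 hcone
  have hF' : ∀ v, ∃ a, v ∈ F → a ∈ T ∧ ι a = v := by
    intro v
    by_cases hv : v ∈ F
    · obtain ⟨a, ha, hav⟩ := hF hv
      exact ⟨a, fun _ => ⟨ha, hav⟩⟩
    · exact ⟨0, fun h => absurd h hv⟩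
  choose a ha using hF'
  obtain ⟨g, hg⟩ := ratl (insert 1 ((F.image (fun v => (f v : ℝ))).filter (0 < ·))) (by
    intro r hr
    rcases Finset.mem_insert.1 hr with rfl | hr
    · exact one_pos
    · exact (Finset.mem_filter.1 hr).2)
  have hg1 : 0 < g 1 := hg 1 (Finset.mem_insert_self _ _)
  have hgf : ∀ v ∈ F, 0 ≤ g (f v) := by
    intro v hv
    rcases (f v).2.eq_or_lt with h0 | h0
    · have : ((f v : NNReal) : ℝ) = 0 := h0.symm
      rw [this, map_zero]
    · exact (hg _ (Finset.mem_insert_of_mem (Finset.mem_filter.2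
        ⟨Finset.mem_image_of_mem _ hv, h0⟩))).le
  have hrel : ∀ i, ∑ v ∈ F, g (f v) * (π (a v) i : ℚ) + g 1 * (π t i : ℚ) = 0 := by
    intro i
    have h1 := congrFun hsum i
    have h2 : ∑ v ∈ F, (π (a v) i : ℚ) • (f v : ℝ) + (π t i : ℚ) • (1 : ℝ) = 0 := by
      have h3 : ∑ v ∈ F, (π (a v) i : ℚ) • (f v : ℝ) = - (π t i : ℝ) := by
        refine Eq.trans ?_ h1
        rw [Finset.sum_apply]
        refine Finset.sum_congr rfl fun v hv => ?_
        have : v i = (π (a v) i : ℝ) := by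
          conv_lhs => rw [← (ha v hv).2]
          rfl
        rw [Pi.smul_apply, NNReal.smul_def, this, Rat.smul_def, smul_eq_mul, mul_comm]
        push_cast; rfl
      rw [h3, Rat.smul_def]; push_cast; ring
    have h4 := congrArg g h2
    rw [map_add, map_sum, map_zero] at h4
    simp only [map_smul, smul_eq_mul] at h4
    rw [← h4]
    congr 1
    · exact Finset.sum_congr rfl fun v _ => mul_comm _ _
    · exact mul_comm _ _
  obtain ⟨D, hD, hk⟩ := clear_den (insert (g 1) (F.image fun v => g (f v))) (by
    intro q hq
    rcases Finset.mem_insert.1 hq with rfl | hq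
    · exact hg1.le
    · obtain ⟨v, hv, rfl⟩ := Finset.mem_image.1 hq
      exact hgf v hv)
  obtain ⟨k1, hk1⟩ := hk _ (Finset.mem_insert_self _ _)
  have hk' : ∀ v, ∃ k : ℕ, v ∈ F → (D : ℚ) * g (f v) = k := by
    intro v
    by_cases hv : v ∈ F
    · obtain ⟨k, h⟩ := hk _ (Finset.mem_insert_of_mem (Finset.mem_image_of_mem _ hv))
      exact ⟨k, fun _ => h⟩
    · exact ⟨0, fun h => absurd h hv⟩
  choose k hkk using hk'
  have hk1pos : 0 < k1 := by
    have : (0:ℚ) < k1 := by rw [← hk1]; positivity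
    exact_mod_cast this
  have hz : π (∑ v ∈ F, k v • a v + k1 • t) = 0 := by
    ext i
    have h1 : ((∑ v ∈ F, (k v : ℤ) * π (a v) i + (k1 : ℤ) * π t i : ℤ) : ℚ) = 0 := by
      push_cast
      rw [← hk1, ← mul_zero (D : ℚ), ← hrel i, mul_add, Finset.mul_sum, mul_assoc]
      congr 1
      refine Finset.sum_congr rfl fun v hv => ?_
      rw [← hkk v hv, mul_assoc]
    have h2 : (∑ v ∈ F, (k v : ℤ) * π (a v) i + (k1 : ℤ) * π t i : ℤ) = 0 := by exact_mod_cast h1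
    simpa using h2
  obtain ⟨m, hm, hm0⟩ := hker _ hz
  obtain ⟨j, hj⟩ : ∃ j, m * k1 = j + 1 := Nat.exists_eq_add_one.2 (Nat.mul_pos hm hk1pos)
  have hfin : -t = m • ∑ v ∈ F, k v • a v + j • t := by
    rw [smul_add, smul_smul, hj, add_smul, one_smul, ← add_assoc] at hm0
    exact (eq_neg_of_add_eq_zero_left hm0).symm
  rw [hfin]
  refine add_mem (nsmul_mem (sum_mem fun v hv => nsmul_mem ?_ _) _) (nsmul_mem ?_ _)
  · exact AddSubmonoid.subset_closure (ha v hv).1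
  · exact AddSubmonoid.subset_closure ht

lemma ab_add {A : Type*} [AddCommGroup A] [AddGroup.FG A] (T : AddSubsemigroup A)
    (hne : ∃ t, t ∈ T)
    (h : ∀ φ : A →+ ℝ, φ ≠ 0 → ∃ t ∈ T, φ t < 0) :
    ∃ H : AddSubgroup A, H.index ≠ 0 ∧ ∀ x, x ∈ H ↔ x ∈ T := by
  have hcl : ∀ x ∈ AddSubmonoid.closure (T : Set A), x = 0 ∨ x ∈ T := by
    intro x hx
    induction hx using AddSubmonoid.closure_induction with
    | mem x hx => exact Or.inr hx
    | zero => exact Or.inl rfl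
    | add x y _ _ hx hy =>
      rcases hx with rfl | hx
      · simpa using hy
      · rcases hy with rfl | hy
        · simpa using Or.inr hx
        · exact Or.inr (T.add_mem hx hy)
  have hn : ∀ t ∈ T, -t = 0 ∨ -t ∈ T := fun t ht => hcl _ (ab_neg (T : Set A) h t ht)
  have h0 : (0 : A) ∈ T := by
    obtain ⟨t, ht⟩ := hne
    rcases hn t ht with h1 | h1
    · rw [neg_eq_zero] at h1; exact h1 ▸ ht
    · simpa using T.add_mem ht h1
  let H : AddSubgroup A :=
    { carrier := T
      zero_mem' := h0
      add_mem' := fun ha hb => T.add_mem ha hb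
      neg_mem' := by
        intro x hx
        rcases hn x hx with h1 | h1
        · rw [h1]; exact h0
        · exact h1 }
  refine ⟨H, ?_, fun x => Iff.rfl⟩
  obtain ⟨n, π, hπ, hker⟩ := coords (A ⧸ H)
  have hz : ∀ x, π x = 0 := by
    intro x
    ext i
    by_contra hxi
    let φ : A →+ ℝ := (Int.castAddHom ℝ).comp ((Pi.evalAddMonoidHom _ i).comp
      (π.comp (QuotientAddGroup.mk' H)))
    obtain ⟨a, rfl⟩ := QuotientAddGroup.mk'_surjective H x
    obtain ⟨t, ht, hlt⟩ := h φ (by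
      intro h0
      have := DFunLike.congr_fun h0 a
      apply hxi
      simpa [φ] using this)
    have : (QuotientAddGroup.mk' H) t = 0 := (QuotientAddGroup.eq_zero_iff t).2 ht
    have h3 : φ t = 0 := by
      simp only [φ, AddMonoidHom.comp_apply, this, map_zero]
    linarith
  have : Finite (A ⧸ H) := by
    apply AddCommGroup.finite_of_fg_isAddTorsion
    intro x
    obtain ⟨m, hm, hx⟩ := hker x (hz x)
    exact isOfFinAddOrder_iff_nsmul_eq_zero.2 ⟨m, hm, hx⟩
  exact AddSubgroup.index_ne_zero_of_finite

section grp
open scoped commutatorElement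

lemma ab_grp {A : Type*} [Group A] [Group.FG A] (hc : ∀ a b : A, a * b = b * a)
    (T : Subsemigroup A) (hne : ∃ t, t ∈ T)
    (h : ∀ φ : A → ℝ, (∀ a b, φ (a * b) = φ a + φ b) → (∃ g, φ g ≠ 0) → ∃ t ∈ T, φ t < 0) :
    ∃ H : Subgroup A, H.index ≠ 0 ∧ ∀ x, x ∈ H ↔ x ∈ T := by
  let _ : CommGroup A := { (inferInstance : Group A) with mul_comm := hc }
  have : AddGroup.FG (Additive A) := inferInstance
  obtain ⟨H, hi, hH⟩ := ab_add (A := Additive A) (Subsemigroup.toAddSubsemigroup T) hne (by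
    intro φ hφ
    obtain ⟨t, ht, hlt⟩ := h (fun a => φ (Additive.ofMul a)) (fun a b => φ.map_add _ _) (by
      by_contra! hcon
      exact hφ (AddMonoidHom.ext fun x => hcon x.toMul))
    exact ⟨Additive.ofMul t, ht, hlt⟩)
  refine ⟨AddSubgroup.toSubgroup' H, ?_, fun x => hH (Additive.ofMul x)⟩
  rw [← Subgroup.index_toAddSubgroup]
  exact hi

lemma comm_mul_left {G : Type*} [Group G] {a b q : G} (h : ⁅b, q⁆ ∈ Subgroup.center G) :
    ⁅a * b, q⁆ = ⁅b, q⁆ * ⁅a, q⁆ := by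
  have h1 := Subgroup.mem_center_iff.1 h a
  have : ⁅a * b, q⁆ = a * ⁅b, q⁆ * (q * a⁻¹ * q⁻¹) := by
    simp only [commutatorElement_def]; group
  rw [this, h1]
  simp only [commutatorElement_def]; group

lemma comm_mul_right {G : Type*} [Group G] {p a b : G} (h : ⁅p, b⁆ ∈ Subgroup.center G) :
    ⁅p, a * b⁆ = ⁅p, a⁆ * ⁅p, b⁆ := by
  have h1 := Subgroup.mem_center_iff.1 h a⁻¹
  have : ⁅p, a * b⁆ = p * a * p⁻¹ * (⁅p, b⁆ * a⁻¹) := by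
    simp only [commutatorElement_def]; group
  rw [this, ← h1]
  simp only [commutatorElement_def]; group

lemma comm_inv_left {G : Type*} [Group G] {a q : G} (h : ⁅a, q⁆ ∈ Subgroup.center G) :
    ⁅a⁻¹, q⁆ = ⁅a, q⁆⁻¹ := by
  have h1 := Subgroup.mem_center_iff.1 (inv_mem h) a⁻¹
  have : ⁅a⁻¹, q⁆ = a⁻¹ * ⁅a, q⁆⁻¹ * a := by
    simp only [commutatorElement_def]; group
  rw [this, h1]; group

lemma comm_inv_right {G : Type*} [Group G] {p a : G} (h : ⁅p, a⁆ ∈ Subgroup.center G) :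
    ⁅p, a⁻¹⁆ = ⁅p, a⁆⁻¹ := by
  have h1 := Subgroup.mem_center_iff.1 (inv_mem h) a⁻¹
  have : ⁅p, a⁻¹⁆ = a⁻¹ * ⁅p, a⁆⁻¹ * a := by
    simp only [commutatorElement_def]; group
  rw [this, h1]; group

lemma comm_pow_left {G : Type*} [Group G] {a q : G} (h : ⁅a, q⁆ ∈ Subgroup.center G) (n : ℕ) :
    ⁅a ^ n, q⁆ = ⁅a, q⁆ ^ n := by
  induction n with
  | zero => simp
  | succ n ih => rw [pow_succ, comm_mul_left h, ih, pow_succ']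

lemma comm_pow_right {G : Type*} [Group G] {a q : G} (h : ⁅a, q⁆ ∈ Subgroup.center G) (n : ℕ) :
    ⁅a, q ^ n⁆ = ⁅a, q⁆ ^ n := by
  induction n with
  | zero => simp
  | succ n ih => rw [pow_succ, comm_mul_right h, ih, pow_succ]

lemma comm_pow {G : Type*} [Group G] {a q : G} (h : ⁅a, q⁆ ∈ Subgroup.center G) (m n : ℕ) :
    ⁅a ^ m, q ^ n⁆ = ⁅a, q⁆ ^ (m * n) := by
  have h1 := comm_pow_left h m
  rw [comm_pow_right (by rw [h1]; exact pow_mem h m), h1, pow_mul]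

lemma four_pow {G : Type*} [Group G] {g h z1 z2 z3 z4 : G} (hc : ⁅g, h⁆ ∈ Subgroup.center G)
    (h1 : z1 ∈ Subgroup.center G) (h2 : z2 ∈ Subgroup.center G) (h3 : z3 ∈ Subgroup.center G)
    (h4 : z4 ∈ Subgroup.center G) (n : ℕ) :
    (g * z1) ^ n * (h * z2) ^ n * (g⁻¹ * z3) ^ n * (h⁻¹ * z4) ^ n =
      ⁅g, h⁆ ^ (n * n) * (z1 * z2 * z3 * z4) ^ n := by
  have key : ∀ (x z : G), z ∈ Subgroup.center G → (x * z) ^ n = x ^ n * z ^ n := fun x z hz =>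
    Commute.mul_pow (Subgroup.mem_center_iff.1 hz x) n
  have e1 := Subgroup.mem_center_iff.1 (pow_mem h1 n)
  have e2 := Subgroup.mem_center_iff.1 (pow_mem h2 n)
  have e3 := Subgroup.mem_center_iff.1 (pow_mem h3 n)
  rw [← comm_pow hc, key _ _ h4, key _ _ h3, key _ _ h2, key _ _ h1, key _ _ h4, key _ _ h3,
    key _ _ h2, commutatorElement_def, inv_pow, inv_pow]
  generalize z1 ^ n = y1 at *
  generalize z2 ^ n = y2 at *
  generalize z3 ^ n = y3 at *
  generalize z4 ^ n = y4 at *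
  generalize g ^ n = u
  generalize h ^ n = v
  calc u * y1 * (v * y2) * (u⁻¹ * y3) * (v⁻¹ * y4)
      = u * ((v * y2 * u⁻¹ * y3 * v⁻¹) * y1) * y4 := by
        rw [e1 (v * y2 * u⁻¹ * y3 * v⁻¹)]; group
    _ = u * v * ((u⁻¹ * y3 * v⁻¹ * y1) * y2) * y4 := by
        rw [e2 (u⁻¹ * y3 * v⁻¹ * y1)]; group
    _ = u * v * u⁻¹ * ((v⁻¹ * y1 * y2) * y3) * y4 := by
        rw [e3 (v⁻¹ * y1 * y2)]; group
    _ = _ := by group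

lemma lcs_quot {G : Type*} [Group G] (n k : ℕ) :
    Subgroup.lowerCentralSeries (⊤ : Subgroup (G ⧸ (⊤ : Subgroup G).lowerCentralSeries n)) k =
    ((⊤ : Subgroup G).lowerCentralSeries k).map
      (QuotientGroup.mk' ((⊤ : Subgroup G).lowerCentralSeries n)) := by
  rw [Subgroup.map_lowerCentralSeries, Subgroup.map_top_of_surjective _
    (QuotientGroup.mk'_surjective _)]

lemma lcs_quot_bot {G : Type*} [Group G] (n : ℕ) :
    Subgroup.lowerCentralSeries (⊤ : Subgroup (G ⧸ (⊤ : Subgroup G).lowerCentralSeries n)) n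
      = ⊥ := by
  rw [lcs_quot, QuotientGroup.map_mk'_self]

lemma lcs_comm_mem {G : Type*} [Group G] {n : ℕ} {p : G}
    (hp : p ∈ (⊤ : Subgroup G).lowerCentralSeries n) (q : G) :
    ⁅p, q⁆ ∈ (⊤ : Subgroup G).lowerCentralSeries (n + 1) :=
  Subgroup.commutator_mem_commutator hp (Subgroup.mem_top q)

lemma lcs_center {G : Type*} [Group G] {n : ℕ}
    (h : (⊤ : Subgroup G).lowerCentralSeries (n + 1) = ⊥) :
    (⊤ : Subgroup G).lowerCentralSeries n ≤ Subgroup.center G := by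
  intro x hx
  rw [Subgroup.mem_center_iff]
  intro g
  have := lcs_comm_mem hx g
  rw [h, Subgroup.mem_bot, commutatorElement_eq_one_iff_mul_comm] at this
  exact this.symm

lemma lcs_fg (n : ℕ) : ∀ (G : Type u) [Group G] [Group.FG G],
    (⊤ : Subgroup G).lowerCentralSeries (n + 1) = ⊥ →
    ((⊤ : Subgroup G).lowerCentralSeries n).FG := by
  classical
  induction n with
  | zero =>
    intro G _ _ _
    exact Group.FG.out
  | succ n ih =>
    intro G _ _ hb
    have hcen := lcs_center hb
    obtain ⟨X', hX'⟩ := ih (G ⧸ (⊤ : Subgroup G).lowerCentralSeries (n + 1)) (lcs_quot_bot _)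
    obtain ⟨Y, hY⟩ := (Group.FG.out : (⊤ : Subgroup G).FG)
    rw [lcs_quot] at hX'
    set π := QuotientGroup.mk' ((⊤ : Subgroup G).lowerCentralSeries (n + 1)) with hπ
    have hlift : ∀ x', ∃ x, x' ∈ X' → x ∈ (⊤ : Subgroup G).lowerCentralSeries n ∧ π x = x' := by
      intro x'
      by_cases hx : x' ∈ X'
      · have : x' ∈ Subgroup.closure (X' : Set _) := Subgroup.subset_closure hx
        rw [hX'] at this
        obtain ⟨x, hx1, hx2⟩ := this
        exact ⟨x, fun _ => ⟨hx1, hx2⟩⟩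
      · exact ⟨1, fun h => absurd h hx⟩
    choose r hr using hlift
    let Z : Finset G := (X' ×ˢ Y).image fun p => ⁅r p.1, p.2⁆
    refine ⟨Z, ?_⟩
    set C := Subgroup.closure (Z : Set G) with hC
    have hcc : ∀ p ∈ (⊤ : Subgroup G).lowerCentralSeries n, ∀ q, ⁅p, q⁆ ∈ Subgroup.center G :=
      fun p hp q => hcen (lcs_comm_mem hp q)
    have s1 : ∀ x ∈ X', ∀ q, ⁅r x, q⁆ ∈ C := by
      intro x hx q
      have hq : q ∈ Subgroup.closure (Y : Set G) := by rw [hY]; trivial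
      have hrx := (hr x hx).1
      induction hq using Subgroup.closure_induction with
      | mem y hy =>
        exact Subgroup.subset_closure (Finset.mem_coe.2 (Finset.mem_image.2
          ⟨(x, y), Finset.mem_product.2 ⟨hx, hy⟩, rfl⟩))
      | one => rw [commutatorElement_one_right]; exact one_mem _
      | mul a b _ _ ha hb => rw [comm_mul_right (hcc _ hrx b)]; exact mul_mem ha hb
      | inv a _ ha => rw [comm_inv_right (hcc _ hrx a)]; exact inv_mem ha
    have s2 : ∀ q, ∀ p ∈ Subgroup.closure (r '' (X' : Set _)),
        p ∈ (⊤ : Subgroup G).lowerCentralSeries n ∧ ⁅p, q⁆ ∈ C := by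
      intro q p hp
      induction hp using Subgroup.closure_induction with
      | mem y hy =>
        obtain ⟨x, hx, rfl⟩ := hy
        exact ⟨(hr x hx).1, s1 x hx q⟩
      | one => rw [commutatorElement_one_left]; exact ⟨one_mem _, one_mem _⟩
      | mul a b _ _ ha hb =>
        rw [comm_mul_left (hcc _ hb.1 q)]; exact ⟨mul_mem ha.1 hb.1, mul_mem hb.2 ha.2⟩
      | inv a _ ha => rw [comm_inv_left (hcc _ ha.1 q)]; exact ⟨inv_mem ha.1, inv_mem ha.2⟩
    have s3 : ∀ p ∈ (⊤ : Subgroup G).lowerCentralSeries n, ∀ q, ⁅p, q⁆ ∈ C := by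
      intro p hp q
      have h1 : π p ∈ Subgroup.closure (X' : Set _) := by
        rw [hX']; exact Subgroup.mem_map_of_mem _ hp
      have h2 : (X' : Set _) = π '' (r '' (X' : Set _)) := by
        rw [Set.image_image]
        ext y
        constructor
        · intro hy; exact ⟨y, hy, (hr y hy).2⟩
        · rintro ⟨z, hz, rfl⟩; dsimp only; rw [(hr z hz).2]; exact hz
      rw [h2, ← MonoidHom.map_closure] at h1
      obtain ⟨x, hx, hxp⟩ := h1
      have h3 : x⁻¹ * p ∈ (⊤ : Subgroup G).lowerCentralSeries (n + 1) := QuotientGroup.eq.1 hxp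
      have h4 : ⁅x⁻¹ * p, q⁆ = 1 := by
        rw [commutatorElement_eq_one_iff_mul_comm]
        exact (Subgroup.mem_center_iff.1 (hcen h3) q).symm
      have h5 : p = x * (x⁻¹ * p) := by group
      rw [h5, comm_mul_left (by rw [h4]; exact one_mem _), h4, one_mul]
      exact (s2 q x hx).2
    apply le_antisymm
    · rw [hC, Subgroup.closure_le]
      intro z hz
      obtain ⟨⟨x, y⟩, hxy, rfl⟩ := Finset.mem_image.1 (Finset.mem_coe.1 hz)
      exact lcs_comm_mem (hr x (Finset.mem_product.1 hxy).1).1 y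
    · intro z hz
      rw [Subgroup.mem_lowerCentralSeries_succ_iff] at hz
      refine (Subgroup.closure_le _).2 ?_ hz
      rintro _ ⟨p, hp, q, -, rfl⟩
      exact s3 p hp q

lemma quad_nonneg {a b : ℝ} (h : ∀ n : ℕ, 0 < n → 0 ≤ (n * n : ℕ) * a + n * b) : 0 ≤ a := by
  by_contra! ha
  obtain ⟨n, hn⟩ := exists_nat_gt (max 1 (b / (-a)))
  have h1 : (1:ℝ) < n := lt_of_le_of_lt (le_max_left _ _) hn
  have h2 : b / (-a) < n := lt_of_le_of_lt (le_max_right _ _) hn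
  rw [div_lt_iff₀ (by linarith)] at h2
  have h3 := h n (by exact_mod_cast (by linarith : (0:ℝ) < n))
  push_cast at h3
  nlinarith

lemma step {G : Type*} [Group G] (n : ℕ) (hb : (⊤ : Subgroup G).lowerCentralSeries (n + 2) = ⊥)
    (hfg : ((⊤ : Subgroup G).lowerCentralSeries (n + 1)).FG)
    (T : Subsemigroup G) (H : Subgroup G) (hi : H.index ≠ 0)
    (hH : ∀ x, x ∈ H ↔ ∃ w ∈ T, ∃ z ∈ (⊤ : Subgroup G).lowerCentralSeries (n + 1), x = w * z) :
    ∃ H' : Subgroup G, H'.index ≠ 0 ∧ ∀ x, x ∈ H' ↔ x ∈ T := by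
  classical
  have hcen := lcs_center hb
  have hmemc : ∀ p ∈ (⊤ : Subgroup G).lowerCentralSeries n, ∀ q,
    ⁅p, q⁆ ∈ (⊤ : Subgroup G).lowerCentralSeries (n + 1) := fun p hp q => lcs_comm_mem hp q
  have hclo := Subgroup.mem_lowerCentralSeries_succ_iff (⊤ : Subgroup G) n
  set K := (⊤ : Subgroup G).lowerCentralSeries (n + 1) with hK
  have : Group.FG K := (Group.fg_iff_subgroup_fg K).2 hfg
  have hcK : ∀ a ∈ K, ∀ g : G, g * a = a * g := fun a ha g =>
    Subgroup.mem_center_iff.1 (hcen ha) g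
  have hrep : ∀ x ∈ H, ∃ z ∈ K, x * z ∈ T := by
    intro x hx
    obtain ⟨w, hw, z, hz, rfl⟩ := (hH x).1 hx
    exact ⟨z⁻¹, inv_mem hz, by simpa using hw⟩
  have hpowT : ∀ t ∈ T, ∀ n : ℕ, 0 < n → t ^ n ∈ T := by
    intro t ht n hn
    induction n, hn using Nat.le_induction with
    | base => simpa using ht
    | succ n _ ih => rw [pow_succ]; exact T.mul_mem ih ht
  obtain ⟨H1, hi1, hH1⟩ := ab_grp (A := K) (fun a b => Subtype.ext (hcK b b.2 a))
    (T.comap (K.subtype : K →ₙ* G)) (by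
      obtain ⟨z, hz, ht⟩ := hrep 1 (one_mem _)
      exact ⟨⟨z, hz⟩, by simpa using ht⟩) (by
      intro φ hφ hne
      by_contra! hcon
      let Φ : G → ℝ := fun x => if h : x ∈ K then φ ⟨x, h⟩ else 0
      have hΦ : ∀ x (h : x ∈ K), Φ x = φ ⟨x, h⟩ := fun x h => dif_pos h
      have hΦm : ∀ x ∈ K, ∀ y ∈ K, Φ (x * y) = Φ x + Φ y := by
        intro x hx y hy
        rw [hΦ x hx, hΦ y hy, hΦ _ (mul_mem hx hy), ← hφ]; rfl
      have hΦ1 : Φ 1 = 0 := by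
        have := hΦm 1 (one_mem _) 1 (one_mem _)
        rw [mul_one] at this; linarith
      have hΦi : ∀ x ∈ K, Φ x⁻¹ = - Φ x := by
        intro x hx
        have := hΦm x hx x⁻¹ (inv_mem hx)
        rw [mul_inv_cancel, hΦ1] at this; linarith
      have hΦp : ∀ x ∈ K, ∀ n : ℕ, Φ (x ^ n) = n * Φ x := by
        intro x hx n
        induction n with
        | zero => simp [hΦ1]
        | succ n ih => rw [pow_succ, hΦm _ (pow_mem hx n) _ hx, ih]; push_cast; ring
      have hcon' : ∀ x ∈ K, x ∈ T → 0 ≤ Φ x := by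
        intro x hx hxT
        rw [hΦ x hx]; exact hcon ⟨x, hx⟩ hxT
      have hnn : ∀ g ∈ H, ∀ h ∈ H, ⁅g, h⁆ ∈ K → 0 ≤ Φ ⁅g, h⁆ := by
        intro g hg h hh hgh
        obtain ⟨z1, hz1, ht1⟩ := hrep g hg
        obtain ⟨z2, hz2, ht2⟩ := hrep h hh
        obtain ⟨z3, hz3, ht3⟩ := hrep g⁻¹ (inv_mem hg)
        obtain ⟨z4, hz4, ht4⟩ := hrep h⁻¹ (inv_mem hh)
        have hz : z1 * z2 * z3 * z4 ∈ K := mul_mem (mul_mem (mul_mem hz1 hz2) hz3) hz4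
        apply quad_nonneg (b := Φ (z1 * z2 * z3 * z4))
        intro n hn
        rw [← hΦp _ hgh, ← hΦp _ hz, ← hΦm _ (pow_mem hgh _) _ (pow_mem hz _)]
        refine hcon' _ (mul_mem (pow_mem hgh _) (pow_mem hz _)) ?_
        rw [← four_pow (hcen hgh) (hcen hz1) (hcen hz2) (hcen hz3) (hcen hz4)]
        exact T.mul_mem (T.mul_mem (T.mul_mem (hpowT _ ht1 n hn) (hpowT _ ht2 n hn))
          (hpowT _ ht3 n hn)) (hpowT _ ht4 n hn)
      have hz0 : ∀ g ∈ H, ∀ h ∈ H, ⁅g, h⁆ ∈ K → Φ ⁅g, h⁆ = 0 := by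
        intro g hg h hh hgh
        apply le_antisymm _ (hnn g hg h hh hgh)
        have h1 : ⁅h, g⁆ = ⁅g, h⁆⁻¹ := (commutatorElement_inv g h).symm
        have h2 := hnn h hh g hg (by rw [h1]; exact inv_mem hgh)
        rw [h1, hΦi _ hgh] at h2
        linarith
      have hz1 : ∀ p ∈ (⊤ : Subgroup G).lowerCentralSeries n, ∀ q, Φ ⁅p, q⁆ = 0 := by
        intro p hp q
        obtain ⟨k, hk, -, hpk⟩ := Subgroup.exists_pow_mem_of_index_ne_zero hi p
        obtain ⟨l, hl, -, hql⟩ := Subgroup.exists_pow_mem_of_index_ne_zero hi q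
        have hpq := hmemc p hp q
        have h1 := comm_pow (hcen hpq) k l
        have h2 := hz0 _ hpk _ hql (by rw [h1]; exact pow_mem hpq _)
        rw [h1, hΦp _ hpq] at h2
        have : ((k * l : ℕ) : ℝ) ≠ 0 := by
          exact_mod_cast (Nat.mul_pos hk hl).ne'
        exact (mul_eq_zero.1 h2).resolve_left this
      obtain ⟨⟨x, hx⟩, hxne⟩ := hne
      apply hxne
      rw [← hΦ x hx]
      have hx' := (hclo x).1 hx
      clear hxne
      have : x ∈ K ∧ Φ x = 0 := by
        clear hx
        induction hx' using Subgroup.closure_induction with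
        | mem y hy =>
          obtain ⟨p, hp, q, -, rfl⟩ := hy
          exact ⟨hmemc p hp q, hz1 p hp q⟩
        | one => exact ⟨one_mem _, hΦ1⟩
        | mul a b _ _ ha hb =>
          exact ⟨mul_mem ha.1 hb.1, by rw [hΦm _ ha.1 _ hb.1, ha.2, hb.2, add_zero]⟩
        | inv a _ ha => exact ⟨inv_mem ha.1, by rw [hΦi _ ha.1, ha.2, neg_zero]⟩
      exact this.2)
  have hKT : ∀ x (hx : x ∈ K), (⟨x, hx⟩ : K) ∈ H1 ↔ x ∈ T := fun x hx => hH1 ⟨x, hx⟩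
  have h1T : (1 : G) ∈ T := (hKT 1 (one_mem _)).1 (one_mem H1)
  have hinvK : ∀ x ∈ K, x ∈ T → x⁻¹ ∈ T := by
    intro x hx hxT
    exact (hKT x⁻¹ (inv_mem hx)).1 (inv_mem ((hKT x hx).2 hxT))
  have hTH : ∀ x ∈ T, x ∈ H := fun x hx => (hH x).2 ⟨x, hx, 1, one_mem _, by simp⟩
  let H' : Subgroup G :=
    { carrier := T
      one_mem' := h1T
      mul_mem' := fun ha hb => T.mul_mem ha hb
      inv_mem' := by
        intro x hx
        obtain ⟨z, hz, ht⟩ := hrep x⁻¹ (inv_mem (hTH x hx))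
        have h1 : z ∈ T := by simpa using T.mul_mem hx ht
        simpa using T.mul_mem ht (hinvK z hz h1) }
  refine ⟨H', ?_, fun x => Iff.rfl⟩
  have hle : H' ≤ H := hTH
  have hKH : K ≤ H := fun z hz => (hH z).2 ⟨1, h1T, z, hz, by simp⟩
  rw [← Subgroup.relIndex_mul_index hle]
  refine mul_ne_zero ?_ hi
  have e1 : H'.subgroupOf K = H1 := by
    ext ⟨x, hx⟩
    exact (hKT x hx).symm
  have hfinK : Finite (K ⧸ H'.subgroupOf K) := by
    rw [e1]
    exact Nat.finite_of_card_ne_zero hi1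
  have hfin : Finite (H ⧸ H'.subgroupOf H) := by
    refine Finite.of_surjective (Subgroup.quotientSubgroupOfEmbeddingOfLE H' hKH) ?_
    intro y
    obtain ⟨⟨x, hx⟩, rfl⟩ := QuotientGroup.mk_surjective y
    obtain ⟨w, hw, z, hz, rfl⟩ := (hH x).1 hx
    refine ⟨QuotientGroup.mk ⟨z, hz⟩, ?_⟩
    rw [Subgroup.quotientSubgroupOfEmbeddingOfLE_apply_mk]
    rw [QuotientGroup.eq]
    change z⁻¹ * (w * z) ∈ T
    rw [hcK z hz w]
    simpa using hw
  exact Nat.card_ne_zero.2 ⟨inferInstance, hfin⟩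

/-- Pull back along a quotient. -/
lemma pull {G : Type*} [Group G] (N : Subgroup G) [N.Normal] (T : Subsemigroup G)
    (H : Subgroup (G ⧸ N)) (hi : H.index ≠ 0)
    (hH : ∀ x, x ∈ H ↔ x ∈ T.map (QuotientGroup.mk' N : G →ₙ* G ⧸ N)) :
    (H.comap (QuotientGroup.mk' N)).index ≠ 0 ∧
      ∀ x, x ∈ H.comap (QuotientGroup.mk' N) ↔ ∃ w ∈ T, ∃ z ∈ N, x = w * z := by
  refine ⟨?_, fun x => ?_⟩
  · rw [Subgroup.index_comap_of_surjective _ (QuotientGroup.mk'_surjective N)]; exact hi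
  · rw [Subgroup.mem_comap, hH]
    constructor
    · rintro ⟨w, hw, hwx⟩
      exact ⟨w, hw, w⁻¹ * x, QuotientGroup.eq.1 hwx, by group⟩
    · rintro ⟨w, hw, z, hz, rfl⟩
      refine ⟨w, hw, QuotientGroup.eq.2 ?_⟩
      simpa using hz

lemma push_hom {G : Type*} [Group G] (N : Subgroup G) [N.Normal] (T : Subsemigroup G)
    (h : ∀ φ : G → ℝ, (∀ a b, φ (a * b) = φ a + φ b) → (∃ g, φ g ≠ 0) → ∃ t ∈ T, φ t < 0)
    (φ : G ⧸ N → ℝ) (hφ : ∀ a b, φ (a * b) = φ a + φ b) (hne : ∃ g, φ g ≠ 0) :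
    ∃ t ∈ T.map (QuotientGroup.mk' N : G →ₙ* G ⧸ N), φ t < 0 := by
  obtain ⟨t, ht, hlt⟩ := h (fun x => φ (QuotientGroup.mk' N x)) (fun a b => by
    rw [map_mul, hφ]) (by
    obtain ⟨g, hg⟩ := hne
    obtain ⟨x, rfl⟩ := QuotientGroup.mk'_surjective N g
    exact ⟨x, hg⟩)
  exact ⟨_, ⟨t, ht, rfl⟩, hlt⟩

lemma main_nil (n : ℕ) : ∀ (G : Type u) [Group G] [Group.FG G],
    (⊤ : Subgroup G).lowerCentralSeries (n + 1) = ⊥ → ∀ (T : Subsemigroup G), (∃ t, t ∈ T) →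
    (∀ φ : G → ℝ, (∀ a b, φ (a * b) = φ a + φ b) → (∃ g, φ g ≠ 0) → ∃ t ∈ T, φ t < 0) →
    ∃ H : Subgroup G, H.index ≠ 0 ∧ ∀ x, x ∈ H ↔ x ∈ T := by
  induction n with
  | zero =>
    intro G _ _ hb T hne h
    refine ab_grp (fun a b => ?_) T hne h
    exact Subgroup.mem_center_iff.1 (lcs_center hb (Subgroup.mem_top b)) a
  | succ n ih =>
    intro G _ _ hb T hne h
    obtain ⟨t, ht⟩ := hne
    obtain ⟨H, hi, hH⟩ := ih (G ⧸ (⊤ : Subgroup G).lowerCentralSeries (n + 1)) (lcs_quot_bot _)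
      (T.map (QuotientGroup.mk' ((⊤ : Subgroup G).lowerCentralSeries (n + 1)) : G →ₙ* _)) ⟨_, t, ht, rfl⟩ (push_hom _ T h)
    obtain ⟨hi', hH'⟩ := pull _ T H hi hH
    exact step n hb (lcs_fg (n + 1) G hb) T _ hi' hH'

end grp

theorem stmt14 {G : Type*} [Group G] [Group.FG G] (c : ℕ) (hc : 2 ≤ c)
    (hG : Subgroup.lowerCentralSeries (⊤ : Subgroup G) c = ⊥)
    (hZ : ∃ ψ : G → ℤ, (∀ a b : G, ψ (a * b) = ψ a + ψ b) ∧ ∃ g : G, ψ g ≠ 0)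
    (S : Set G)
    (h : ∀ φ : G → ℝ, (∀ a b : G, φ (a * b) = φ a + φ b) → (∃ g : G, φ g ≠ 0) →
      ∃ s ∈ S, φ s < 0) :
    ∃ H : Subgroup G, H.index ≠ 0 ∧
      (H : Set G) = {x : G | ∃ w ∈ Subsemigroup.closure S,
        ∃ z ∈ Subgroup.lowerCentralSeries (⊤ : Subgroup G) (c - 1), x = w * z} := by
  obtain ⟨n, rfl⟩ : ∃ n, c = n + 2 := ⟨c - 2, by omega⟩
  have e : n + 2 - 1 = n + 1 := rfl
  rw [e]
  have h' : ∀ φ : G → ℝ, (∀ a b, φ (a * b) = φ a + φ b) → (∃ g, φ g ≠ 0) →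
      ∃ t ∈ Subsemigroup.closure S, φ t < 0 := by
    intro φ h1 h2
    obtain ⟨s, hs, hlt⟩ := h φ h1 h2
    exact ⟨s, Subsemigroup.subset_closure hs, hlt⟩
  obtain ⟨t, ht⟩ : ∃ t, t ∈ Subsemigroup.closure S := by
    obtain ⟨ψ, h1, g, hg⟩ := hZ
    obtain ⟨t, ht, -⟩ := h' (fun x => (ψ x : ℝ)) (fun a b => by rw [h1]; push_cast; rfl)
      ⟨g, by exact_mod_cast hg⟩
    exact ⟨t, ht⟩
  obtain ⟨H, hi, hH⟩ := main_nil n (G ⧸ (⊤ : Subgroup G).lowerCentralSeries (n + 1))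
    (lcs_quot_bot _) ((Subsemigroup.closure S).map
      (QuotientGroup.mk' ((⊤ : Subgroup G).lowerCentralSeries (n + 1)) : G →ₙ* _))
    ⟨_, t, ht, rfl⟩ (push_hom _ _ h')
  obtain ⟨hi', hH'⟩ := pull _ _ H hi hH
  exact ⟨_, hi', Set.ext hH'⟩
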